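/- Let f(x,y) = 45y² − 47xy − 30x² + 96y³ − xy² + 8x²y + 54x³ − 96y⁴ − 64xy³ − 50x²y² − 33x³y + 91x⁴ − 100y⁵ + 84xy⁴ − 43x³y² + 66x⁴y − 58x⁵ + 70y⁶ + 90xy⁵ − 28x²y⁴ − 53x³y³ + 43x⁴y² + 36x⁵y − 38x⁶. Then the hessian curve Z = {(x,y) ∈ ℝ² : Hess(f)(x,y) = 0} is a compact subset of ℝ² and has exactly 11 connected components. -/

import Mathlib

open MvPolynomial

/-- The hessian determinant of a polynomial in two variables over the reals:
`Hess f = f_xx * f_yy - f_xy ^ 2` (with formal partial derivatives). -/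
noncomputable def Hess (f : MvPolynomial (Fin 2) ℝ) : MvPolynomial (Fin 2) ℝ :=
  pderiv 0 (pderiv 0 f) * pderiv 1 (pderiv 1 f) - (pderiv 0 (pderiv 1 f)) ^ 2

/-- The set of connected components of a set `Z ⊆ ℝ × ℝ` (with its subspace
topology), viewed as subsets of `ℝ × ℝ`. -/
def components (Z : Set (ℝ × ℝ)) : Set (Set (ℝ × ℝ)) :=
  {C | ∃ p ∈ Z, C = connectedComponentIn Z p}

/-- The polynomial `f` of the statement. -/
noncomputable def f : MvPolynomial (Fin 2) ℝ :=
  45 * (X 1)^2 - 47 * (X 0)*(X 1) - 30 * (X 0)^2 + 96 * (X 1)^3 - (X 0)*(X 1)^2 + 8 * (X 0)^2*(X 1) + 54 * (X 0)^3 - 96 * (X 1)^4 - 64 * (X 0)*(X 1)^3 - 50 * (X 0)^2*(X 1)^2 - 33 * (X 0)^3*(X 1) + 91 * (X 0)^4 - 100 * (X 1)^5 + 84 * (X 0)*(X 1)^4 - 43 * (X 0)^3*(X 1)^2 + 66 * (X 0)^4*(X 1) - 58 * (X 0)^5 + 70 * (X 1)^6 + 90 * (X 0)*(X 1)^5 -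 28 * (X 0)^2*(X 1)^4 - 53 * (X 0)^3*(X 1)^3 + 43 * (X 0)^4*(X 1)^2 + 36 * (X 0)^5*(X 1) - 38 * (X 0)^6

/-- The hessian curve of `f` in `ℝ²`. -/
noncomputable def Z : Set (ℝ × ℝ) := {p | eval ![p.1, p.2] (Hess f) = 0}

/-! ### Star-shaped ovals -/

section Oval

open Set Filter Topology

variable {E : Type*} [NormedAddCommGroup E] [NormedSpace ℝ E] {H : E → ℝ} {U V : Set E} {c : E}

theorem exists_zero_on_ray (hH : Differentiable ℝ H) (hU : IsOpen U) (hV : IsOpen V)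
    (hUV : Disjoint U V) (hcU : c ∈ U) (hc : 0 < H c) (hcover : ∀ p, 0 ≤ H p → p ∈ U ∪ V)
    {ρ : ℝ} (hρ : ∀ p, ρ ≤ ‖p‖ → H p < 0) {v : E} (hv : ‖v‖ = 1) :
    ∃ t : ℝ, 0 < t ∧ c + t • v ∈ U ∧ H (c + t • v) = 0 := by
  have hline : Continuous fun t : ℝ => c + t • v := by fun_prop
  have hcont : Continuous fun t : ℝ => H (c + t • v) := hH.continuous.comp hline
  have h₀ : 0 < H (c + (0 : ℝ) • v) := by simpa using hc
  have hfar : H (c + (|ρ| + ‖c‖) • v) < 0 := hρ _ <| by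
    have h₁ := norm_sub_le (c + (|ρ| + ‖c‖) • v) c
    rw [add_sub_cancel_left, norm_smul, hv, mul_one, Real.norm_of_nonneg (by positivity)] at h₁
    linarith [le_abs_self ρ]
  have hzero {T : ℝ} (hT : 0 ≤ T) (h : H (c + T • v) ≤ 0) :
      ∃ t ∈ Icc 0 T, H (c + t • v) = 0 :=
    intermediate_value_Icc' hT hcont.continuousOn ⟨h, h₀.le⟩
  have hK : IsCompact (Icc 0 (|ρ| + ‖c‖) ∩ {t : ℝ | H (c + t • v) = 0}) :=
    isCompact_Icc.inter_right (isClosed_eq hcont continuous_const)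
  obtain ⟨t, ⟨⟨ht₀, ht₁⟩, ht⟩, hmin⟩ := hK.exists_isLeast (hzero (by positivity) hfar.le)
  have hseg : ∀ s ∈ Icc 0 t, 0 ≤ H (c + s • v) := fun s hs => by
    by_contra! hneg
    obtain ⟨r, hr, hr0⟩ := hzero hs.1 hneg.le
    obtain rfl : s = r := le_antisymm (hs.2.trans (hmin ⟨⟨hr.1, (hr.2.trans hs.2).trans ht₁⟩, hr0⟩))
      hr.2
    exact hneg.ne hr0
  have hsub : (fun s : ℝ => c + s • v) '' Icc 0 t ⊆ U :=
    (isPreconnected_Icc.image _ hline.continuousOn).subset_left_of_subset_union hU hV hUV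
      (image_subset_iff.2 fun s hs => hcover _ (hseg s hs))
      ⟨c, ⟨0, ⟨le_rfl, ht₀⟩, by simp⟩, hcU⟩
  refine ⟨t, ht₀.lt_of_ne ?_, hsub ⟨t, ⟨ht₀, le_rfl⟩, rfl⟩, ht⟩
  rintro rfl
  exact h₀.ne' ht

theorem zero_on_ray_unique (hH : Differentiable ℝ H) (hconv : Convex ℝ U)
    (hderiv : ∀ p ∈ U, H p = 0 → 0 < fderiv ℝ H p (c - p)) {v : E} {s t : ℝ} (hs₀ : 0 < s)
    (hs : c + s • v ∈ U) (hs' : H (c + s • v) = 0) (ht : c + t • v ∈ U) (ht' : H (c + t • v) = 0) :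
    t ≤ s := by
  by_contra! hst
  have hline (r : ℝ) : HasDerivAt (fun r : ℝ => H (c + r • v)) (fderiv ℝ H (c + r • v) v) r :=
    (hH _).hasFDerivAt.comp_hasDerivAt r
      (by simpa using ((hasDerivAt_id r).smul_const v).const_add c)
  have hU : ∀ r ∈ Icc s t, c + r • v ∈ U := fun r hr => by
    have hpre : Convex ℝ ((AffineMap.lineMap c (c + v) : ℝ →ᵃ[ℝ] E) ⁻¹' U) :=
      hconv.affine_preimage _
    have := hpre.ordConnected.out (x := s) (by simpa [AffineMap.lineMap_apply, add_comm] using hs)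
      (y := t) (by simpa [AffineMap.lineMap_apply, add_comm] using ht) hr
    simpa [AffineMap.lineMap_apply, add_comm] using this
  have hneg : ∀ r ∈ Icc s t, H (c + r • v) = 0 → fderiv ℝ H (c + r • v) v < 0 := fun r hr h => by
    have := hderiv _ (hU r hr) h
    rw [sub_add_cancel_left, map_neg, map_smul, smul_eq_mul] at this
    nlinarith [hr.1]
  have hle : ∀ ⦃r⦄, r ∈ Icc s t → H (c + r • v) ≤ 0 :=
    image_le_of_deriv_right_lt_deriv_boundary (B := fun _ => 0) (B' := fun _ => 0)
      (fun r _ => (hline r).continuousAt.continuousWithinAt)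
      (fun r _ => (hline r).hasDerivWithinAt) hs'.le (fun r => hasDerivAt_const r 0)
      fun r hr h => hneg r ⟨hr.1, hr.2.le⟩ h
  have hslope : ∀ᶠ r in 𝓝[<] t, slope (fun r : ℝ => H (c + r • v)) t r < 0 :=
    ((hasDerivAt_iff_tendsto_slope.1 (hline t)).mono_left
      (nhdsWithin_mono t fun r (hr : r < t) => hr.ne)).eventually
      (gt_mem_nhds (hneg t ⟨hst.le, le_rfl⟩ ht'))
  obtain ⟨r, hr, hrs, hrt⟩ := (hslope.and (Ioo_mem_nhdsLT hst)).exists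
  rw [slope_def_field, ht', sub_zero] at hr
  exact hr.not_ge (div_nonneg_of_nonpos (hle ⟨hrs.le, hrt.le⟩) (by linarith))

theorem isCompact_zeros_inter [ProperSpace E] (hH : Differentiable ℝ H) (hV : IsOpen V)
    (hUV : Disjoint U V) (hcover : ∀ p, 0 ≤ H p → p ∈ U ∪ V) {ρ : ℝ}
    (hρ : ∀ p, ρ ≤ ‖p‖ → H p < 0) : IsCompact ({p | H p = 0} ∩ U) := by
  have hclosed : IsClosed ({p | H p = 0} ∩ Vᶜ) :=
    (isClosed_eq hH.continuous continuous_const).inter hV.isClosed_compl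
  have heq : {p | H p = 0} ∩ U = {p | H p = 0} ∩ Vᶜ := by
    ext p
    refine and_congr_right fun (hp : H p = 0) => ⟨fun h => disjoint_left.1 hUV h, fun h => ?_⟩
    exact (hcover p hp.ge).resolve_right h
  rw [heq]
  refine (isCompact_closedBall (0 : E) ρ).of_isClosed_subset hclosed fun p hp => ?_
  rw [mem_closedBall_zero_iff]
  by_contra! h
  exact (hρ p h.le).ne hp.1

/-- If `H` increases towards `c` along its zero set in the convex open set `U`, then that zero set
is connected, because the radial projection maps it homeomorphically to a sphere. -/
theorem isConnected_zeros_inter [ProperSpace E] (hE : 1 < Module.rank ℝ E)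
    (hH : Differentiable ℝ H) (hU : IsOpen U) (hconv : Convex ℝ U) (hV : IsOpen V)
    (hUV : Disjoint U V) (hcU : c ∈ U) (hc : 0 < H c) (hcover : ∀ p, 0 ≤ H p → p ∈ U ∪ V) {ρ : ℝ}
    (hρ : ∀ p, ρ ≤ ‖p‖ → H p < 0)
    (hderiv : ∀ p ∈ U, H p = 0 → 0 < fderiv ℝ H p (c - p)) :
    IsConnected ({p | H p = 0} ∩ U) := by
  set K := {p | H p = 0} ∩ U
  have : CompactSpace K :=
    isCompact_iff_compactSpace.1 (isCompact_zeros_inter hH hV hUV hcover hρ)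
  have hne (p : K) : 0 < ‖(p : E) - c‖ := norm_sub_pos_iff.2 fun h => hc.ne' (h ▸ p.2.1)
  have hray (p : K) : c + ‖(p : E) - c‖ • ‖(p : E) - c‖⁻¹ • ((p : E) - c) = p := by
    rw [smul_inv_smul₀ (hne p).ne', add_sub_cancel]
  let π : K → Metric.sphere (0 : E) 1 := fun p => ⟨‖(p : E) - c‖⁻¹ • ((p : E) - c), by
    simp [norm_smul, (hne p).ne']⟩
  have hπ : Continuous π := by
    refine Continuous.subtype_mk (.smul (.inv₀ (by fun_prop) fun p => (hne p).ne') (by fun_prop)) _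
  have hinj : Function.Injective π := fun p q hpq => by
    have hv : ‖(p : E) - c‖⁻¹ • ((p : E) - c) = ‖(q : E) - c‖⁻¹ • ((q : E) - c) :=
      congrArg Subtype.val hpq
    have hp := hray p
    have hq := hray q
    rw [← hv] at hq
    have hle : ‖(q : E) - c‖ ≤ ‖(p : E) - c‖ :=
      zero_on_ray_unique hH hconv hderiv (hne p) (by rw [hp]; exact p.2.2) (by rw [hp]; exact p.2.1)
        (by rw [hq]; exact q.2.2) (by rw [hq]; exact q.2.1)
    have hge : ‖(p : E) - c‖ ≤ ‖(q : E) - c‖ :=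
      zero_on_ray_unique hH hconv hderiv (hne q) (by rw [hq]; exact q.2.2) (by rw [hq]; exact q.2.1)
        (by rw [hp]; exact p.2.2) (by rw [hp]; exact p.2.1)
    rw [Subtype.ext_iff, ← hp, ← hq, hle.antisymm hge]
  have hsurj : Function.Surjective π := fun ⟨v, hv⟩ => by
    rw [mem_sphere_zero_iff_norm] at hv
    obtain ⟨t, ht, htU, ht0⟩ := exists_zero_on_ray hH hU hV hUV hcU hc hcover hρ hv
    refine ⟨⟨c + t • v, ht0, htU⟩, Subtype.ext ?_⟩
    simp [π, norm_smul, hv, abs_of_pos ht, ht.ne']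
  let e : K ≃ₜ Metric.sphere (0 : E) 1 :=
    Continuous.homeoOfEquivCompactToT2 (f := Equiv.ofBijective π ⟨hinj, hsurj⟩) hπ
  have : ConnectedSpace (Metric.sphere (0 : E) 1) :=
    isConnected_iff_connectedSpace.1 (isConnected_sphere hE 0 zero_le_one)
  exact isConnected_iff_connectedSpace.2 (e.symm.surjective.connectedSpace e.symm.continuous)

end Oval

theorem ncard_components_of_ovals {ι : Type*} [Fintype ι] {H : ℝ × ℝ → ℝ} {U : ι → Set (ℝ × ℝ)}
    {c : ι → ℝ × ℝ} (hH : Differentiable ℝ H) (hU : ∀ i, IsOpen (U i))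
    (hconv : ∀ i, Convex ℝ (U i)) (hdisj : Pairwise fun i j => Disjoint (U i) (U j))
    (hcU : ∀ i, c i ∈ U i) (hc : ∀ i, 0 < H (c i)) (hcover : ∀ p, 0 ≤ H p → ∃ i, p ∈ U i) {ρ : ℝ}
    (hρ : ∀ p, ρ ≤ ‖p‖ → H p < 0)
    (hderiv : ∀ i, ∀ p ∈ U i, H p = 0 → 0 < fderiv ℝ H p (c i - p)) :
    IsCompact {p | H p = 0} ∧ (components {p | H p = 0}).ncard = Fintype.card ι := by
  have hV (i : ι) : IsOpen (⋃ j ≠ i, U j) := isOpen_biUnion fun j _ => hU j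
  have hUV (i : ι) : Disjoint (U i) (⋃ j ≠ i, U j) :=
    Set.disjoint_iUnion₂_right.2 fun j hj => hdisj hj.symm
  have hcov (i : ι) (p : ℝ × ℝ) (hp : 0 ≤ H p) : p ∈ U i ∪ ⋃ j ≠ i, U j := by
    obtain ⟨j, hj⟩ := hcover p hp
    by_cases h : j = i
    · exact .inl (h ▸ hj)
    · exact .inr (Set.mem_biUnion h hj)
  have hrank : 1 < Module.rank ℝ (ℝ × ℝ) := by simp [one_add_one_eq_two]
  have hconn (i : ι) : IsConnected ({p | H p = 0} ∩ U i) :=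
    isConnected_zeros_inter hrank hH (hU i) (hconv i) (hV i) (hUV i) (hcU i) (hc i) (hcov i) hρ
      (hderiv i)
  have hcomp {i : ι} {p : ℝ × ℝ} (hp : H p = 0) (hpi : p ∈ U i) :
      connectedComponentIn {p | H p = 0} p = {p | H p = 0} ∩ U i := by
    refine Set.Subset.antisymm (Set.subset_inter (connectedComponentIn_subset _ _) ?_)
      ((hconn i).isPreconnected.subset_connectedComponentIn ⟨hp, hpi⟩ Set.inter_subset_left)
    exact isPreconnected_connectedComponentIn.subset_left_of_subset_union (hU i) (hV i) (hUV i)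
      (fun q hq => hcov i q (connectedComponentIn_subset _ _ hq).ge)
      ⟨p, mem_connectedComponentIn hp, hpi⟩
  constructor
  · simpa using isCompact_zeros_inter (U := Set.univ) hH isOpen_empty (Set.disjoint_empty _)
      (fun _ _ => .inl trivial) hρ
  · have hrange : components {p | H p = 0} = Set.range fun i => {p | H p = 0} ∩ U i := by
      ext C
      constructor
      · rintro ⟨p, hp, rfl⟩
        obtain ⟨i, hi⟩ := hcover p (le_of_eq (Eq.symm hp))
        exact ⟨i, (hcomp hp hi).symm⟩
      · rintro ⟨i, rfl⟩
        obtain ⟨p, hp, hpi⟩ := (hconn i).nonempty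
        exact ⟨p, hp, (hcomp hp hpi).symm⟩
    have hinj : Function.Injective fun i => {p | H p = 0} ∩ U i := fun i j hij => by
      by_contra hne
      obtain ⟨p, hp⟩ := (hconn i).nonempty
      exact Set.disjoint_left.1 (hdisj hne) hp.2 ((Set.ext_iff.1 hij p).1 hp).2
    rw [hrange, ← Set.image_univ, Set.ncard_image_of_injective _ hinj, Set.ncard_univ,
      Nat.card_eq_fintype_card]

/-! ### Binary and ternary forms as coefficient lists -/

/-- The binary form `∑ gⱼ a ^ (n - j) b ^ j` with coefficient list `[g₀, …, gₙ]`. -/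
def evalBinary : List ℤ → ℝ → ℝ → ℝ
  | [], _, _ => 0
  | g :: l, a, b => g * a ^ l.length + b * evalBinary l a b

/-- The ternary form `∑ Lₖ(a, b) c ^ k` whose rows `Lₖ` are binary forms of decreasing degree. -/
def evalTernary : List (List ℤ) → ℝ → ℝ → ℝ → ℝ
  | [], _, _, _ => 0
  | L :: G, a, b, c => evalBinary L a b + c * evalTernary G a b c

/-- The rows of a coefficient list have lengths `n, n - 1, …, 1`. -/
def IsTriangle : ℕ → List (List ℤ) → Prop
  | 0, G => G = []
  | n + 1, G => ∃ L G', G = L :: G' ∧ L.length = n + 1 ∧ IsTriangle n G'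

/-! ### Arithmetic that is cheap in the kernel

The functions evaluated by the kernel are written with recursors, which it unfolds much faster than
definitions by structural recursion. -/

/-- Addition of integers. -/
noncomputable def addInt (m n : ℤ) : ℤ :=
  Int.rec
    (fun a => Int.rec (fun b => .ofNat (Nat.add a b))
      (fun b => Nat.rec (.ofNat (Nat.sub a (Nat.succ b))) (fun k _ => .negSucc k)
        (Nat.sub (Nat.succ b) a)) n)
    (fun a => Int.rec (fun b => Nat.rec (.ofNat (Nat.sub b (Nat.succ a))) (fun k _ => .negSucc k)
        (Nat.sub (Nat.succ a) b))
      (fun b => .negSucc (Nat.succ (Nat.add a b))) n) m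

/-- Pass a numeral in normal form to the continuation `k`. -/
noncomputable def forceNat {β : Type} (n : ℕ) : (ℕ → β) → β :=
  Nat.rec (fun k => k 0) (fun m _ k => k (Nat.succ m)) n

noncomputable def forceInt {β : Type} (n : ℤ) : (ℤ → β) → β :=
  Int.rec (fun m k => forceNat m fun m' => k (.ofNat m'))
    (fun m k => forceNat m fun m' => k (.negSucc m')) n

noncomputable def forceRow {β : Type} (l : List ℤ) : (List ℤ → β) → β :=
  List.rec (fun k => k []) (fun x _ ih k => forceInt x fun x' => ih fun l' => k (x' :: l')) l

noncomputable def forceRows {β : Type} (G : List (List ℤ)) : (List (List ℤ) → β) → β :=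
  List.rec (fun k => k []) (fun L _ ih k => forceRow L fun L' => ih fun G' => k (L' :: G')) G

noncomputable def posInt (n : ℤ) : Bool :=
  Int.rec (fun a => Nat.ble 1 a) (fun _ => false) n

noncomputable def negInt (n : ℤ) : Bool := Int.rec (fun _ => false) (fun _ => true) n

noncomputable def allRow (p : ℤ → Bool) (l : List ℤ) : Bool :=
  List.rec true (fun x _ ih => Bool.rec false ih (p x)) l

noncomputable def allRows (p : ℤ → Bool) (G : List (List ℤ)) : Bool :=
  List.rec true (fun L _ ih => Bool.rec false ih (allRow p L)) G

/-! ### Substitutions in ternary forms -/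

/-- The coefficients of `(a + b) l + p a ^ n + g b ^ n`, where `l` is a binary form of degree
`n - 1`. -/
noncomputable def hornerStep (l : List ℤ) : ℤ → ℤ → List ℤ :=
  List.rec (fun p g => [addInt p g]) (fun x _ ih p g => addInt p x :: ih x g) l

/-- Given a form `acc`, append to its expansion in powers of `a + b` the coefficients `l`. -/
noncomputable def shearRow (l : List ℤ) : List ℤ → List ℤ :=
  List.rec (fun acc => acc) (fun g _ ih acc => ih (hornerStep acc 0 g)) l

/-- The substitution `(a, b) ↦ (a + b, b)`. -/
noncomputable def shear (G : List (List ℤ)) : List (List ℤ) :=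
  List.rec [] (fun L _ ih => shearRow L [] :: ih) G

/-- The substitution `(a, b) ↦ (b, a + b)` in a binary form. -/
noncomputable def turnRow (l : List ℤ) : List ℤ :=
  List.rec [] (fun g _ ih => hornerStep ih 0 g) l

/-- The substitution `(a, b) ↦ (b, a + b)`. -/
noncomputable def turn (G : List (List ℤ)) : List (List ℤ) :=
  List.rec [] (fun L _ ih => turnRow L :: ih) G

noncomputable def reverseRow (l : List ℤ) : List ℤ → List ℤ :=
  List.rec (fun acc => acc) (fun x _ ih acc => ih (x :: acc)) l

/-- The substitution exchanging `a` and `b`. -/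
noncomputable def swapFst (G : List (List ℤ)) : List (List ℤ) :=
  List.rec [] (fun L _ ih => reverseRow L [] :: ih) G

noncomputable def consColumn (l : List ℤ) : List (List ℤ) → List (List ℤ) :=
  List.rec (fun _ => []) (fun x _ ih G =>
    List.rec ([x] :: ih []) (fun M G' _ => (x :: M) :: ih G') G) l

/-- The substitution exchanging `b` and `c`. -/
noncomputable def swapSnd (G : List (List ℤ)) : List (List ℤ) :=
  List.rec [] (fun L _ ih => consColumn L ih) G

/-- One row of `derivForm`: the coefficients `A x + B y + C m`, where `x`, `y` are consecutive
entries of `L`, `m` is the corresponding entry of `M`, and `A`, `B` vary in steps of `-α`, `β`. -/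
noncomputable def derivRow (α β C : ℤ) (M : List ℤ) : List ℤ → ℤ → ℤ → List ℤ :=
  List.rec (fun _ _ _ => []) (fun m _ ih L A B =>
    List.rec [] (fun x L' _ => List.rec [] (fun y _ _ =>
      addInt (Int.mul A x) (addInt (Int.mul B y) (Int.mul C m)) ::
        forceInt (addInt A (Int.neg α)) fun A' => forceInt (addInt B β) fun B' => ih L' A' B')
      L') L) M

/-- The derivative `α ∂ₐ + β ∂_b + γ ∂_c` of the ternary form with rows `L :: G`, with `C = γ` and
`n` the degree. -/
noncomputable def derivForm (α β γ : ℤ) (G : List (List ℤ)) : List ℤ → ℤ → ℕ → List (List ℤ) :=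
  List.rec (fun _ _ _ => []) (fun M _ ih L C n =>
    derivRow α β C M L (Int.mul α (Int.ofNat n)) β ::
      forceInt (addInt C γ) fun C' => ih M C' (Nat.pred n)) G

/-! ### The checker -/

/-- An integer vector in homogeneous coordinates. -/
structure Vec where
  x : ℤ
  y : ℤ
  z : ℤ

noncomputable def forceVec {β : Type} (v : Vec) (k : Vec → β) : β :=
  forceInt v.x fun x => forceInt v.y fun y => forceInt v.z fun z => k ⟨x, y, z⟩

def Vec.add (u v : Vec) : Vec := ⟨u.x + v.x, u.y + v.y, u.z + v.z⟩

def Vec.dot (u v : Vec) : ℤ := u.x * v.x + u.y * v.y + u.z * v.z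

def Vec.det (u v w : Vec) : ℤ :=
  u.x * (v.y * w.z - v.z * w.y) - u.y * (v.x * w.z - v.z * w.x) + u.z * (v.x * w.y - v.y * w.x)

/-- The coefficients of the homogenized Hessian of `f`, listed as a ternary form of degree 8. -/
def hessRows : List (List ℤ) :=
  [[-130440, 300600, 251840, -2076540, -1410485, 2042160, 909140, -567000, -320100],
   [-96760, 286320, -648420, 512220, -2423120, 399000, 188280, -190400],
   [273616, 209700, -428730, 3906016, -350676, 402024, -85584],
   [98744, -332240, 2481880, -2348504, 1237664, 332168],
   [-243833, -984720, -445938, -759212, -41060],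
   [-105840, 556404, -571596, 74784],
   [94070, 173076, 51284],
   [30784, -33308],
   [-7609]]

/-- Eleven centers (in homogeneous coordinates), each followed by the linear forms that are positive on
a convex region around it. -/
def regions : List (Vec × List Vec) :=
  [(⟨-125, 94, 10⟩, [⟨-2, 0, -1⟩, ⟨0, 2, 0⟩, ⟨-8, 2, -14⟩]),
   (⟨-31, -33, 20⟩, [⟨-2, 0, -1⟩, ⟨0, -2, 0⟩, ⟨3, -12, -4⟩, ⟨0, -5, -2⟩]),
   (⟨4, -7, 10⟩, [⟨2, 0, 1⟩, ⟨0, -2, 0⟩, ⟨12, -3, -4⟩, ⟨-2, -2, 0⟩, ⟨0, -5, -2⟩]),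
   (⟨-37, -11, 20⟩, [⟨-2, 0, -1⟩, ⟨0, -2, 0⟩, ⟨-3, 12, 4⟩, ⟨-8, -6, -14⟩]),
   (⟨7, -4, 10⟩, [⟨2, 0, 1⟩, ⟨0, -2, 0⟩, ⟨12, -3, -4⟩, ⟨2, 2, 0⟩, ⟨3, -12, -4⟩]),
   (⟨-3, -7, 20⟩, [⟨2, 0, 1⟩, ⟨0, -2, 0⟩, ⟨-12, 3, 4⟩, ⟨-2, -2, 0⟩, ⟨4, -4, 1⟩]),
   (⟨-23, 2, 20⟩, [⟨-12, 3, 4⟩, ⟨-8, 2, -1⟩, ⟨-4, 4, -1⟩, ⟨0, 5, 2⟩, ⟨8, -2, 14⟩, ⟨-2, -4, 1⟩, ⟨8, 6, 14⟩]),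
   (⟨9, 3, 20⟩, [⟨2, 0, 1⟩, ⟨8, -2, 1⟩, ⟨2, 2, 0⟩, ⟨-3, 12, 4⟩, ⟨4, -4, 1⟩, ⟨0, 5, 2⟩, ⟨-8, -6, 9⟩, ⟨-3, -6, 5⟩]),
   (⟨9, 4, 8⟩, [⟨2, 0, 1⟩, ⟨0, 2, 0⟩, ⟨12, -3, -4⟩, ⟨8, -6, -4⟩, ⟨8, 6, -9⟩]),
   (⟨0, 13, 20⟩, [⟨2, 0, 1⟩, ⟨0, 2, 0⟩, ⟨-12, 3, 4⟩, ⟨-4, 4, -1⟩, ⟨2, 4, -1⟩, ⟨-8, -2, 4⟩]),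
   (⟨15, 17, 20⟩, [⟨2, 0, 1⟩, ⟨0, 2, 0⟩, ⟨8, -2, 1⟩, ⟨-8, 6, 4⟩, ⟨8, 2, -4⟩, ⟨3, 6, -5⟩])]

/-- The substitution `a ↦ s a`, `b ↦ t b` in a binary form. -/
def rescaleRow (s t : ℤ) : List ℤ → List ℤ
  | [] => []
  | g :: l => g * s ^ l.length :: (rescaleRow s t l).map (t * ·)

/-- The substitution `a ↦ s a`, `b ↦ t b`, `c ↦ u c`. -/
def rescale (s t u : ℤ) : List (List ℤ) → List (List ℤ)
  | [] => []
  | L :: G => rescaleRow s t L :: (rescale s t u G).map (List.map (u * ·))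

/-- The vertex `v` lies strictly inside the region given by the linear forms `r`. -/
noncomputable def insideRegion (r : List Vec) (v : Vec) : Bool :=
  List.rec (posInt v.z) (fun l _ ih => Bool.rec false ih (posInt (l.dot v))) r

/-- The derivative of `G` in the direction of the point `o`, expressed in the basis `u, v, w` up to
the factor `det u v w`, whose sign is corrected for, is positive. -/
noncomputable def posDeriv (o : Vec) (G : List (List ℤ)) (u v w : Vec) : Bool :=
  forceInt (u.det v w) fun d => forceInt (o.det v w) fun α => forceInt (u.det o w) fun β =>
    forceInt (u.det v o) fun γ =>
      (posInt d && allRows posInt (derivForm α β γ G.tail G.headI γ 8)) ||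
        (negInt d && allRows posInt (derivForm (-α) (-β) (-γ) G.tail G.headI (-γ) 8))

noncomputable def regionLeaf (i : ℕ) (G : List (List ℤ)) (u v w : Vec) : Bool :=
  match regions[i]? with
  | none => false
  | some (o, r) => insideRegion r u && insideRegion r v && insideRegion r w &&
      (allRows posInt G || posDeriv o G u v w)

/-- Walk through a subdivision of the cone spanned by `u, v, w`, in which the ternary form is given
by `G`. The base 16 digits of `s`, from the last one, tell what to do: close a cone where the
form is negative (`0`), bisect (`1`), permute the vertices (`2`, `3`), or close a cone inside a
region (`i + 4`). The unused digits are returned. -/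
noncomputable def check : ℕ → List (List ℤ) → Vec → Vec → Vec → ℕ → Option ℕ
  | 0, _, _, _, _, _ => none
  | n + 1, G, u, v, w, s =>
    forceNat (s % 16) fun d => forceNat (s / 16) fun s' =>
      match d with
      | 0 => if allRows negInt G then some s' else none
      | 1 => forceVec (u.add v) fun m =>
          (forceRows (shear G) fun G₁ => check n G₁ u m w s').bind
            fun s'' => forceRows (turn G) fun G₂ => check n G₂ v m w s''
      | 2 => forceRows (swapSnd G) fun G' => check n G' u w v s'
      | 3 => forceRows (swapSnd (swapFst G)) fun G' => check n G' v w u s'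
      | i + 4 => if regionLeaf i G u v w then some s' else none

/-- Check the cone spanned by `(3σ, 0, 0)`, `(0, 3τ, 0)` and `(0, 0, 2)`. -/
noncomputable def checkOctant (σ τ : ℤ) (s : ℕ) : Bool :=
  forceRows (rescale (3 * σ) (3 * τ) 2 hessRows) fun G =>
    check 100 G ⟨3 * σ, 0, 0⟩ ⟨0, 3 * τ, 0⟩ ⟨0, 0, 2⟩ s == some 0

/-! ### Correctness of the arithmetic -/

theorem ofNat_sub_eq (a b : ℕ) :
    (Nat.rec (.ofNat (Nat.sub a b)) (fun k _ => .negSucc k) (Nat.sub b a) : ℤ) = a - b := by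
  rcases h : Nat.sub b a with _ | k
  · change ((a - b : ℕ) : ℤ) = _
    have : b - a = 0 := h
    omega
  · change Int.negSucc k = _
    have : b - a = k + 1 := h
    omega

theorem addInt_eq (m n : ℤ) : addInt m n = m + n := by
  rcases m with a | a <;> rcases n with b | b
  · rfl
  · refine (ofNat_sub_eq a (b + 1)).trans ?_
    simp [Int.negSucc_eq]
    ring
  · refine (ofNat_sub_eq b (a + 1)).trans ?_
    simp [Int.negSucc_eq]
    ring
  · rfl

theorem forceNat_eq {β : Type} (n : ℕ) (k : ℕ → β) : forceNat n k = k n := by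
  cases n <;> rfl

theorem forceInt_eq {β : Type} (n : ℤ) (k : ℤ → β) : forceInt n k = k n := by
  cases n <;> exact forceNat_eq _ _

theorem forceRow_eq {β : Type} (l : List ℤ) (k : List ℤ → β) : forceRow l k = k l := by
  induction l generalizing k with
  | nil => rfl
  | cons x l ih => exact (forceInt_eq _ _).trans (ih _)

theorem forceRows_eq {β : Type} (G : List (List ℤ)) (k : List (List ℤ) → β) :
    forceRows G k = k G := by
  induction G generalizing k with
  | nil => rfl
  | cons L G ih => exact (forceRow_eq _ _).trans (ih _)

theorem forceVec_eq {β : Type} (v : Vec) (k : Vec → β) : forceVec v k = k v := by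
  simp [forceVec, forceInt_eq]

theorem posInt_iff (n : ℤ) : posInt n = true ↔ 0 < n := by
  cases n with
  | ofNat a =>
    have h : Nat.ble 1 a = true ↔ 1 ≤ a := Nat.ble_eq ▸ Iff.rfl
    exact h.trans Int.natCast_pos.symm
  | negSucc a => simp [posInt]

theorem negInt_iff (n : ℤ) : negInt n = true ↔ n < 0 := by
  cases n with
  | ofNat a => simp [negInt]
  | negSucc a => simp [negInt, Int.negSucc_lt_zero]

theorem boolRec_eq_and (x y : Bool) : (Bool.rec false y x : Bool) = (x && y) := by
  cases x <;> rfl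

theorem allRow_iff (p : ℤ → Bool) (l : List ℤ) : allRow p l = true ↔ ∀ x ∈ l, p x = true := by
  induction l with
  | nil => simp [allRow]
  | cons x l ih =>
    rw [show allRow p (x :: l) = (p x && allRow p l) from boolRec_eq_and _ _]
    simp [ih]

theorem allRows_iff (p : ℤ → Bool) (G : List (List ℤ)) :
    allRows p G = true ↔ ∀ L ∈ G, ∀ x ∈ L, p x = true := by
  induction G with
  | nil => simp [allRows]
  | cons L G ih =>
    rw [show allRows p (L :: G) = (allRow p L && allRows p G) from boolRec_eq_and _ _]
    simp [ih, allRow_iff]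

/-! ### Correctness of the substitutions -/

@[simp] theorem evalBinary_nil (a b : ℝ) : evalBinary [] a b = 0 := rfl

theorem evalBinary_cons (g : ℤ) (l : List ℤ) (a b : ℝ) :
    evalBinary (g :: l) a b = g * a ^ l.length + b * evalBinary l a b := rfl

theorem evalTernary_cons (L : List ℤ) (G : List (List ℤ)) (a b c : ℝ) :
    evalTernary (L :: G) a b c = evalBinary L a b + c * evalTernary G a b c := rfl

theorem IsTriangle.cons {n : ℕ} {L : List ℤ} {G : List (List ℤ)} (hL : L.length = n + 1)
    (hG : IsTriangle n G) : IsTriangle (n + 1) (L :: G) :=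
  ⟨L, G, rfl, hL, hG⟩

theorem hornerStep_cons (x : ℤ) (l : List ℤ) (p g : ℤ) :
    hornerStep (x :: l) p g = addInt p x :: hornerStep l x g := rfl

theorem length_hornerStep (l : List ℤ) (p g : ℤ) : (hornerStep l p g).length = l.length + 1 := by
  induction l generalizing p with
  | nil => rfl
  | cons x l ih => simp [hornerStep_cons, ih]

theorem evalBinary_hornerStep (l : List ℤ) (p g : ℤ) (a b : ℝ) :
    evalBinary (hornerStep l p g) a b =
      p * a ^ l.length + (a + b) * evalBinary l a b + g * b ^ l.length := by
  induction l generalizing p with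
  | nil => simp [hornerStep, evalBinary, addInt_eq]
  | cons x l ih =>
    simp only [hornerStep_cons, evalBinary_cons, ih, length_hornerStep, addInt_eq, List.length_cons]
    push_cast
    ring

theorem shearRow_cons (g : ℤ) (l acc : List ℤ) :
    shearRow (g :: l) acc = shearRow l (hornerStep acc 0 g) := rfl

theorem length_shearRow (l acc : List ℤ) : (shearRow l acc).length = l.length + acc.length := by
  induction l generalizing acc with
  | nil => simp [shearRow]
  | cons g l ih =>
    simp only [shearRow_cons, ih, length_hornerStep, List.length_cons]
    ring

theorem evalBinary_shearRow (l acc : List ℤ) (a b : ℝ) :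
    evalBinary (shearRow l acc) a b =
      (a + b) ^ l.length * evalBinary acc a b + b ^ acc.length * evalBinary l (a + b) b := by
  induction l generalizing acc with
  | nil => simp [shearRow]
  | cons g l ih =>
    simp only [shearRow_cons, ih, evalBinary_hornerStep, evalBinary_cons, length_hornerStep,
      List.length_cons]
    push_cast
    ring

theorem IsTriangle.shear {n : ℕ} {G : List (List ℤ)} (h : IsTriangle n G) :
    IsTriangle n (shear G) := by
  induction n generalizing G with
  | zero => subst h; rfl
  | succ n ih =>
    obtain ⟨L, G, rfl, hL, hG⟩ := h
    exact .cons (by simp [length_shearRow, hL]) (ih hG)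

theorem evalTernary_shear (G : List (List ℤ)) (a b c : ℝ) :
    evalTernary (shear G) a b c = evalTernary G (a + b) b c := by
  induction G with
  | nil => rfl
  | cons L G ih =>
    rw [show shear (L :: G) = shearRow L [] :: shear G from rfl, evalTernary_cons, ih,
      evalBinary_shearRow, evalTernary_cons]
    simp

theorem turnRow_cons (g : ℤ) (l : List ℤ) :
    turnRow (g :: l) = hornerStep (turnRow l) 0 g := rfl

theorem length_turnRow (l : List ℤ) : (turnRow l).length = l.length := by
  induction l with
  | nil => rfl
  | cons g l ih => simp [turnRow_cons, length_hornerStep, ih]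

theorem evalBinary_turnRow (l : List ℤ) (a b : ℝ) :
    evalBinary (turnRow l) a b = evalBinary l b (a + b) := by
  induction l with
  | nil => rfl
  | cons g l ih =>
    simp only [turnRow_cons, evalBinary_hornerStep, ih, length_turnRow, evalBinary_cons]
    push_cast
    ring

theorem IsTriangle.turn {n : ℕ} {G : List (List ℤ)} (h : IsTriangle n G) :
    IsTriangle n (turn G) := by
  induction n generalizing G with
  | zero => subst h; rfl
  | succ n ih =>
    obtain ⟨L, G, rfl, hL, hG⟩ := h
    exact .cons (by simp [length_turnRow, hL]) (ih hG)

theorem evalTernary_turn (G : List (List ℤ)) (a b c : ℝ) :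
    evalTernary (turn G) a b c = evalTernary G b (a + b) c := by
  induction G with
  | nil => rfl
  | cons L G ih =>
    rw [show turn (L :: G) = turnRow L :: turn G from rfl, evalTernary_cons, ih,
      evalBinary_turnRow, evalTernary_cons]

theorem reverseRow_cons (x : ℤ) (l acc : List ℤ) :
    reverseRow (x :: l) acc = reverseRow l (x :: acc) := rfl

theorem length_reverseRow (l acc : List ℤ) :
    (reverseRow l acc).length = l.length + acc.length := by
  induction l generalizing acc with
  | nil => simp [reverseRow]
  | cons g l ih =>
    simp only [reverseRow_cons, ih, List.length_cons]
    ring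

theorem evalBinary_reverseRow (l acc : List ℤ) (a b : ℝ) :
    evalBinary (reverseRow l acc) a b =
      a ^ acc.length * evalBinary l b a + b ^ l.length * evalBinary acc a b := by
  induction l generalizing acc with
  | nil => simp [reverseRow]
  | cons g l ih =>
    simp only [reverseRow_cons, ih, evalBinary_cons, List.length_cons]
    ring

theorem IsTriangle.swapFst {n : ℕ} {G : List (List ℤ)} (h : IsTriangle n G) :
    IsTriangle n (swapFst G) := by
  induction n generalizing G with
  | zero => subst h; rfl
  | succ n ih =>
    obtain ⟨L, G, rfl, hL, hG⟩ := h
    exact .cons (by simp [length_reverseRow, hL]) (ih hG)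

theorem evalTernary_swapFst (G : List (List ℤ)) (a b c : ℝ) :
    evalTernary (swapFst G) a b c = evalTernary G b a c := by
  induction G with
  | nil => rfl
  | cons L G ih =>
    rw [show swapFst (L :: G) = reverseRow L [] :: swapFst G from rfl, evalTernary_cons, ih,
      evalBinary_reverseRow, evalTernary_cons]
    simp

theorem IsTriangle.consColumn {n : ℕ} {L : List ℤ} {G : List (List ℤ)} (hL : L.length = n + 1)
    (hG : IsTriangle n G) : IsTriangle (n + 1) (consColumn L G) := by
  induction n generalizing L G with
  | zero =>
    subst hG
    obtain ⟨x, rfl⟩ := List.length_eq_one_iff.1 hL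
    exact .cons rfl rfl
  | succ n ih =>
    obtain ⟨M, G, rfl, hM, hG⟩ := hG
    obtain ⟨x, L, rfl⟩ := List.exists_cons_of_length_eq_add_one hL
    exact .cons (by simpa using hM) (ih (by simpa using hL) hG)

theorem evalTernary_consColumn {n : ℕ} {L : List ℤ} {G : List (List ℤ)} (hL : L.length = n + 1)
    (hG : IsTriangle n G) (a b c : ℝ) :
    evalTernary (consColumn L G) a b c = evalBinary L a c + b * evalTernary G a b c := by
  induction n generalizing L G with
  | zero =>
    subst hG
    obtain ⟨x, rfl⟩ := List.length_eq_one_iff.1 hL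
    simp [consColumn, evalTernary, evalBinary]
  | succ n ih =>
    obtain ⟨M, G, rfl, hM, hG⟩ := hG
    obtain ⟨x, L, rfl⟩ := List.exists_cons_of_length_eq_add_one hL
    have hL' : L.length = n + 1 := by simpa using hL
    rw [show _root_.consColumn (x :: L) (M :: G) = (x :: M) :: _root_.consColumn L G from rfl]
    simp only [evalTernary_cons, evalBinary_cons, ih hL' hG, hL', hM]
    ring

theorem IsTriangle.swapSnd {n : ℕ} {G : List (List ℤ)} (h : IsTriangle n G) :
    IsTriangle n (swapSnd G) := by
  induction n generalizing G with
  | zero => subst h; rfl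
  | succ n ih =>
    obtain ⟨L, G, rfl, hL, hG⟩ := h
    exact .consColumn hL (ih hG)

theorem evalTernary_swapSnd {n : ℕ} {G : List (List ℤ)} (h : IsTriangle n G) (a b c : ℝ) :
    evalTernary (swapSnd G) a b c = evalTernary G a c b := by
  induction n generalizing G with
  | zero => subst h; rfl
  | succ n ih =>
    obtain ⟨L, G, rfl, hL, hG⟩ := h
    exact (evalTernary_consColumn hL hG.swapSnd a b c).trans (by rw [ih hG, evalTernary_cons])

theorem length_rescaleRow (s t : ℤ) (l : List ℤ) : (rescaleRow s t l).length = l.length := by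
  induction l with
  | nil => rfl
  | cons g l ih => simp [rescaleRow, ih]

theorem evalBinary_map_mul (t : ℤ) (l : List ℤ) (a b : ℝ) :
    evalBinary (l.map (t * ·)) a b = t * evalBinary l a b := by
  induction l with
  | nil => simp
  | cons g l ih =>
    simp only [List.map_cons, evalBinary_cons, ih, List.length_map]
    push_cast
    ring

theorem evalBinary_rescaleRow (s t : ℤ) (l : List ℤ) (a b : ℝ) :
    evalBinary (rescaleRow s t l) a b = evalBinary l (s * a) (t * b) := by
  induction l with
  | nil => rfl
  | cons g l ih =>
    simp only [rescaleRow, evalBinary_cons, evalBinary_map_mul, ih, List.length_map,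
      length_rescaleRow]
    push_cast
    ring

theorem evalTernary_map_map_mul (u : ℤ) (G : List (List ℤ)) (a b c : ℝ) :
    evalTernary (G.map (List.map (u * ·))) a b c = u * evalTernary G a b c := by
  induction G with
  | nil => simp [evalTernary]
  | cons L G ih =>
    simp only [List.map_cons, evalTernary_cons, evalBinary_map_mul, ih]
    ring

theorem evalTernary_rescale (s t u : ℤ) (G : List (List ℤ)) (a b c : ℝ) :
    evalTernary (rescale s t u G) a b c = evalTernary G (s * a) (t * b) (u * c) := by
  induction G with
  | nil => rfl
  | cons L G ih =>
    simp only [rescale, evalTernary_cons, evalTernary_map_map_mul, ih, evalBinary_rescaleRow]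
    ring

theorem IsTriangle.map_map {n : ℕ} {G : List (List ℤ)} (h : IsTriangle n G) (p : ℤ → ℤ) :
    IsTriangle n (G.map (List.map p)) := by
  induction n generalizing G with
  | zero => subst h; rfl
  | succ n ih =>
    obtain ⟨L, G, rfl, hL, hG⟩ := h
    exact .cons (by simpa using hL) (ih hG)

theorem IsTriangle.rescale {n : ℕ} {G : List (List ℤ)} (h : IsTriangle n G) (s t u : ℤ) :
    IsTriangle n (rescale s t u G) := by
  induction n generalizing G with
  | zero => subst h; rfl
  | succ n ih =>
    obtain ⟨L, G, rfl, hL, hG⟩ := h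
    exact .cons (by simpa [length_rescaleRow] using hL) ((ih hG).map_map _)

/-! ### Signs and derivatives -/

theorem evalBinary_nonneg {l : List ℤ} (h : ∀ x ∈ l, 0 < x) {a b : ℝ} (ha : 0 ≤ a) (hb : 0 ≤ b) :
    0 ≤ evalBinary l a b := by
  induction l with
  | nil => rfl
  | cons g l ih =>
    have hg : (0 : ℝ) < g := by exact_mod_cast h g (by simp)
    have := ih fun x hx => h x (by simp [hx])
    rw [evalBinary_cons]
    positivity

theorem evalBinary_pos {n : ℕ} {l : List ℤ} (hl : l.length = n + 1) (h : ∀ x ∈ l, 0 < x) {a b : ℝ}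
    (ha : 0 ≤ a) (hb : 0 ≤ b) (hab : a ≠ 0 ∨ b ≠ 0) : 0 < evalBinary l a b := by
  induction n generalizing l with
  | zero =>
    obtain ⟨x, rfl⟩ := List.length_eq_one_iff.1 hl
    simpa [evalBinary] using h
  | succ n ih =>
    obtain ⟨g, l, rfl⟩ := List.exists_cons_of_length_eq_add_one hl
    have hg : (0 : ℝ) < g := by exact_mod_cast h g (by simp)
    have hl' : ∀ x ∈ l, 0 < x := fun x hx => h x (by simp [hx])
    rw [evalBinary_cons]
    rcases ha.eq_or_lt with rfl | ha
    · have hb' : 0 < b := hb.lt_of_ne' (by simpa using hab)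
      have := ih (by simpa using hl) hl'
      positivity
    · have := evalBinary_nonneg hl' ha.le hb
      positivity

theorem evalTernary_nonneg {G : List (List ℤ)} (h : ∀ L ∈ G, ∀ x ∈ L, 0 < x) {a b c : ℝ}
    (ha : 0 ≤ a) (hb : 0 ≤ b) (hc : 0 ≤ c) : 0 ≤ evalTernary G a b c := by
  induction G with
  | nil => rfl
  | cons L G ih =>
    have h₁ := evalBinary_nonneg (h L (by simp)) ha hb
    have h₂ := ih fun M hM => h M (by simp [hM])
    rw [evalTernary_cons]
    positivity

theorem evalTernary_pos {n : ℕ} {G : List (List ℤ)} (hG : IsTriangle (n + 1) G)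
    (h : ∀ L ∈ G, ∀ x ∈ L, 0 < x) {a b c : ℝ} (ha : 0 ≤ a) (hb : 0 ≤ b) (hc : 0 ≤ c)
    (habc : ¬(a = 0 ∧ b = 0 ∧ c = 0)) : 0 < evalTernary G a b c := by
  induction n generalizing G with
  | zero =>
    obtain ⟨L, G, rfl, hL, rfl⟩ := hG
    obtain ⟨x, rfl⟩ := List.length_eq_one_iff.1 hL
    simpa [evalTernary, evalBinary] using h
  | succ n ih =>
    obtain ⟨L, G, rfl, hL, hG⟩ := hG
    have hG' : ∀ M ∈ G, ∀ x ∈ M, 0 < x := fun M hM => h M (by simp [hM])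
    rw [evalTernary_cons]
    by_cases hab : a = 0 ∧ b = 0
    · obtain ⟨rfl, rfl⟩ := hab
      have hc' : 0 < c := hc.lt_of_ne' (by simpa using habc)
      have h₁ := evalBinary_nonneg (h L (by simp)) le_rfl (le_refl (0 : ℝ))
      have h₂ := ih hG hG'
      positivity
    · have h₁ := evalBinary_pos hL (h L (by simp)) ha hb (by tauto)
      have h₂ := evalTernary_nonneg hG' ha hb hc
      positivity

theorem evalTernary_pos_of_allRows {n : ℕ} {G : List (List ℤ)} (hG : IsTriangle (n + 1) G)
    (h : allRows posInt G = true) {a b c : ℝ} (ha : 0 ≤ a) (hb : 0 ≤ b) (hc : 0 ≤ c)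
    (habc : ¬(a = 0 ∧ b = 0 ∧ c = 0)) : 0 < evalTernary G a b c :=
  evalTernary_pos hG (fun L hL x hx => (posInt_iff x).1 ((allRows_iff _ _).1 h L hL x hx))
    ha hb hc habc

theorem evalTernary_neg_of_allRows {n : ℕ} {G : List (List ℤ)} (hG : IsTriangle (n + 1) G)
    (h : allRows negInt G = true) {a b c : ℝ} (ha : 0 ≤ a) (hb : 0 ≤ b) (hc : 0 ≤ c)
    (habc : ¬(a = 0 ∧ b = 0 ∧ c = 0)) : evalTernary G a b c < 0 := by
  have := evalTernary_pos (hG.map_map (-1 * ·)) (fun L hL x hx => by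
    obtain ⟨M, hM, rfl⟩ := List.mem_map.1 hL
    obtain ⟨y, hy, rfl⟩ := List.mem_map.1 hx
    have := (negInt_iff y).1 ((allRows_iff _ _).1 h M hM y hy)
    omega) ha hb hc habc
  rw [evalTernary_map_map_mul] at this
  push_cast at this
  linarith

theorem derivRow_cons (α β C m : ℤ) (M : List ℤ) (x y : ℤ) (L : List ℤ) (A B : ℤ) :
    derivRow α β C (m :: M) (x :: y :: L) A B =
      (A * x + (B * y + C * m)) :: derivRow α β C M (y :: L) (A - α) (B + β) := by
  refine Eq.trans (b := addInt (A * x) (addInt (B * y) (C * m)) ::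
    forceInt (addInt A (-α)) fun A' => forceInt (addInt B β) fun B' =>
      derivRow α β C M (y :: L) A' B') rfl ?_
  simp only [forceInt_eq, addInt_eq, sub_eq_add_neg]

theorem length_derivRow (α β C : ℤ) {M L : List ℤ} (h : L.length = M.length + 1) (A B : ℤ) :
    (derivRow α β C M L A B).length = M.length := by
  induction M generalizing L A B with
  | nil => rfl
  | cons m M ih =>
    match L, h with
    | x :: y :: L, h => simp [derivRow_cons, ih (L := y :: L) (by simpa using h)]

theorem hasDerivAt_evalBinary (α β C : ℤ) {M L : List ℤ} {x : ℤ} (h : L.length = M.length)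
    (j : ℤ) (a b : ℝ) :
    HasDerivAt (fun t : ℝ => evalBinary (x :: L) (a + t * α) (b + t * β))
      (evalBinary (derivRow α β C M (x :: L) (α * M.length) (β * j)) a b
        - (j - 1) * β * evalBinary L a b - C * evalBinary M a b) 0 := by
  induction M generalizing L x j with
  | nil =>
    obtain rfl := List.length_eq_zero_iff.1 h
    simpa [evalBinary, derivRow] using hasDerivAt_const (0 : ℝ) (x : ℝ)
  | cons m M ih =>
    obtain ⟨y, L, rfl⟩ := List.exists_cons_of_length_eq_add_one h
    have hL : L.length = M.length := by simpa using h
    have hlin (p q : ℝ) : HasDerivAt (fun t : ℝ => p + t * q) q 0 := by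
      simpa using ((hasDerivAt_id (0 : ℝ)).mul_const q).const_add p
    have h₁ := ((hlin a α).pow (M.length + 1)).const_mul (x : ℝ)
    have h₂ := (hlin b β).mul (ih (x := y) hL (j + 1))
    refine ((h₁.add h₂).congr_deriv ?_).congr_of_eventuallyEq (.of_forall fun t => ?_)
    · simp only [derivRow_cons, evalBinary_cons, length_derivRow _ _ _ (L := y :: L) (M := M)
        (by simp [hL]), hL, List.length_cons]
      have e₁ : α * ((M.length + 1 : ℕ) : ℤ) - α = α * M.length := by push_cast; ring
      have e₂ : β * j + β = β * (j + 1) := by ring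
      rw [e₁, e₂]
      push_cast
      simp
      ring
    · simp [evalBinary_cons, hL]

theorem derivForm_cons (α β γ : ℤ) (M L : List ℤ) (G : List (List ℤ)) (C : ℤ) (n : ℕ) :
    derivForm α β γ (M :: G) L C (n + 1) =
      derivRow α β C M L (α * (n + 1 : ℕ)) β :: derivForm α β γ G M (C + γ) n := by
  refine Eq.trans (b := derivRow α β C M L (α * (n + 1 : ℕ)) β ::
    forceInt (addInt C γ) fun C' => derivForm α β γ G M C' n) rfl ?_
  simp only [forceInt_eq, addInt_eq]

theorem IsTriangle.derivForm (α β γ : ℤ) {n : ℕ} {L : List ℤ} {G : List (List ℤ)}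
    (hL : L.length = n + 1) (hG : IsTriangle n G) (C : ℤ) :
    IsTriangle n (derivForm α β γ G L C n) := by
  induction n generalizing L G C with
  | zero => subst hG; rfl
  | succ n ih =>
    obtain ⟨M, G, rfl, hM, hG⟩ := hG
    rw [derivForm_cons]
    exact .cons (by rw [length_derivRow _ _ _ (by omega), hM]) (ih hM hG _)

theorem hasDerivAt_evalTernary (α β γ : ℤ) {n : ℕ} {L : List ℤ} {G : List (List ℤ)}
    (hL : L.length = n + 1) (hG : IsTriangle n G) (k : ℤ) (a b c : ℝ) :
    HasDerivAt (fun t : ℝ => evalTernary (L :: G) (a + t * α) (b + t * β) (c + t * γ))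
      (evalTernary (derivForm α β γ G L (γ * k) n) a b c
        - (k - 1) * γ * evalTernary G a b c) 0 := by
  induction n generalizing L G k with
  | zero =>
    subst hG
    obtain ⟨x, rfl⟩ := List.length_eq_one_iff.1 hL
    simpa [evalTernary, evalBinary, derivForm] using hasDerivAt_const (0 : ℝ) (x : ℝ)
  | succ n ih =>
    obtain ⟨M, G, rfl, hM, hG⟩ := hG
    obtain ⟨x, L, rfl⟩ := List.exists_cons_of_length_eq_add_one hL
    have hlin (p q : ℝ) : HasDerivAt (fun t : ℝ => p + t * q) q 0 := by
      simpa using ((hasDerivAt_id (0 : ℝ)).mul_const q).const_add p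
    have h₁ := hasDerivAt_evalBinary α β (γ * k) (x := x) (L := L) (M := M)
      (by simp at hL; omega) 1 a b
    have h₂ := (hlin c γ).mul (ih hM hG (k + 1))
    refine ((h₁.add h₂).congr_deriv ?_).congr_of_eventuallyEq (.of_forall fun t => ?_)
    · rw [derivForm_cons, mul_one, hM, show γ * k + γ = γ * (k + 1) by ring]
      simp only [evalTernary_cons]
      push_cast
      simp
      ring
    · simp [evalTernary_cons]

/-! ### Soundness of the checker -/

/-- What the checker establishes about the homogenized Hessian at a point: it is negative, or the
point is in one of the regions and the form is positive or increases towards the center. -/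
def Settled (x y z : ℝ) : Prop :=
  evalTernary hessRows x y z < 0 ∨ ∃ R ∈ regions, 0 < z ∧
    (∀ l ∈ R.2, 0 < l.x * x + l.y * y + l.z * z) ∧
    (0 < evalTernary hessRows x y z ∨ ∃ r d : ℝ, 0 < r ∧ 0 < d ∧
      HasDerivAt (fun t : ℝ => evalTernary hessRows (x + t * (r * R.1.x)) (y + t * (r * R.1.y))
        (z + t * (r * R.1.z))) d 0)

theorem linear_pos {a b c p q r : ℝ} (ha : 0 ≤ a) (hb : 0 ≤ b) (hc : 0 ≤ c)
    (habc : ¬(a = 0 ∧ b = 0 ∧ c = 0)) (hp : 0 < p) (hq : 0 < q) (hr : 0 < r) :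
    0 < a * p + b * q + c * r := by
  by_contra! h
  have h₁ := mul_nonneg ha hp.le
  have h₂ := mul_nonneg hb hq.le
  have h₃ := mul_nonneg hc hr.le
  refine habc ⟨?_, ?_, ?_⟩
  · exact (mul_eq_zero_iff_right hp.ne').1 (by linarith)
  · exact (mul_eq_zero_iff_right hq.ne').1 (by linarith)
  · exact (mul_eq_zero_iff_right hr.ne').1 (by linarith)

theorem insideRegion_iff (r : List Vec) (v : Vec) :
    insideRegion r v = true ↔ 0 < v.z ∧ ∀ l ∈ r, 0 < l.dot v := by
  induction r with
  | nil => simpa [insideRegion] using posInt_iff v.z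
  | cons l r ih =>
    rw [show insideRegion (l :: r) v = (posInt (l.dot v) && insideRegion r v) from
      boolRec_eq_and _ _]
    simp only [Bool.and_eq_true, posInt_iff, ih, List.mem_cons, forall_eq_or_imp]
    tauto

theorem insideRegion_comb {r : List Vec} {u v w : Vec} (hu : insideRegion r u = true)
    (hv : insideRegion r v = true) (hw : insideRegion r w = true) {a b c : ℝ}
    (ha : 0 ≤ a) (hb : 0 ≤ b) (hc : 0 ≤ c) (habc : ¬(a = 0 ∧ b = 0 ∧ c = 0)) :
    0 < a * u.z + b * v.z + c * w.z ∧ ∀ l ∈ r,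
      0 < l.x * (a * u.x + b * v.x + c * w.x) + l.y * (a * u.y + b * v.y + c * w.y)
        + l.z * (a * u.z + b * v.z + c * w.z) := by
  rw [insideRegion_iff] at hu hv hw
  refine ⟨linear_pos ha hb hc habc (mod_cast hu.1) (mod_cast hv.1) (mod_cast hw.1), fun l hl => ?_⟩
  have key (v : Vec) (h : 0 < l.dot v) : (0 : ℝ) < l.x * v.x + l.y * v.y + l.z * v.z := by
    exact_mod_cast h
  have := linear_pos ha hb hc habc (key u (hu.2 l hl)) (key v (hv.2 l hl)) (key w (hw.2 l hl))
  linarith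

theorem exists_hasDerivAt_of_posDeriv {F : ℝ → ℝ → ℝ → ℝ} {o u v w : Vec} {G : List (List ℤ)}
    (h : posDeriv o G u v w = true) (hG : IsTriangle 9 G)
    (hF : ∀ a b c, evalTernary G a b c = F (a * u.x + b * v.x + c * w.x)
      (a * u.y + b * v.y + c * w.y) (a * u.z + b * v.z + c * w.z)) {a b c : ℝ}
    (ha : 0 ≤ a) (hb : 0 ≤ b) (hc : 0 ≤ c) (habc : ¬(a = 0 ∧ b = 0 ∧ c = 0)) :
    ∃ r d : ℝ, 0 < r ∧ 0 < d ∧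
      HasDerivAt (fun t : ℝ => F (a * u.x + b * v.x + c * w.x + t * (r * o.x))
        (a * u.y + b * v.y + c * w.y + t * (r * o.y))
        (a * u.z + b * v.z + c * w.z + t * (r * o.z))) d 0 := by
  obtain ⟨L, G, rfl, hL, hG'⟩ := hG
  have key (ε : ℤ) (hd : 0 < ε * u.det v w)
      (hrows : allRows posInt (derivForm (ε * o.det v w) (ε * u.det o w) (ε * u.det v o) G L
        (ε * u.det v o) 8) = true) : ∃ r d : ℝ, 0 < r ∧ 0 < d ∧
      HasDerivAt (fun t : ℝ => F (a * u.x + b * v.x + c * w.x + t * (r * o.x))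
        (a * u.y + b * v.y + c * w.y + t * (r * o.y))
        (a * u.z + b * v.z + c * w.z + t * (r * o.z))) d 0 := by
    have hd₁ := hasDerivAt_evalTernary (ε * o.det v w) (ε * u.det o w) (ε * u.det v o) hL hG' 1
      a b c
    rw [mul_one] at hd₁
    refine ⟨(ε * u.det v w : ℤ), _, by exact_mod_cast hd, evalTernary_pos_of_allRows
      (.derivForm _ _ _ hL hG' _) hrows ha hb hc habc,
      (hd₁.congr_deriv (by push_cast; ring)).congr_of_eventuallyEq (.of_forall fun t => ?_)⟩
    dsimp only
    rw [hF]
    simp only [Vec.det]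
    push_cast
    congr 1 <;> ring
  simp only [posDeriv, forceInt_eq, Bool.or_eq_true, Bool.and_eq_true, posInt_iff, negInt_iff,
    List.tail_cons, List.headI_cons] at h
  rcases h with ⟨hd, h⟩ | ⟨hd, h⟩
  · exact key 1 (by simpa using hd) (by simpa using h)
  · exact key (-1) (by simpa using hd) (by simpa using h)

theorem settled_of_regionLeaf {i : ℕ} {u v w : Vec} {G : List (List ℤ)}
    (h : regionLeaf i G u v w = true) (hG : IsTriangle 9 G)
    (hF : ∀ a b c, evalTernary G a b c = evalTernary hessRows (a * u.x + b * v.x + c * w.x)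
      (a * u.y + b * v.y + c * w.y) (a * u.z + b * v.z + c * w.z)) {a b c : ℝ}
    (ha : 0 ≤ a) (hb : 0 ≤ b) (hc : 0 ≤ c) (habc : ¬(a = 0 ∧ b = 0 ∧ c = 0)) :
    Settled (a * u.x + b * v.x + c * w.x) (a * u.y + b * v.y + c * w.y)
      (a * u.z + b * v.z + c * w.z) := by
  unfold regionLeaf at h
  rcases hR : regions[i]? with _ | ⟨o, r⟩
  · simp [hR] at h
  simp only [hR, Bool.and_eq_true, Bool.or_eq_true] at h
  obtain ⟨⟨⟨hu, hv⟩, hw⟩, h⟩ := h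
  obtain ⟨hz, hr⟩ := insideRegion_comb hu hv hw ha hb hc habc
  refine .inr ⟨(o, r), List.mem_of_getElem? hR, hz, hr, h.imp (fun h => ?_) fun h =>
    exists_hasDerivAt_of_posDeriv h hG hF ha hb hc habc⟩
  rw [← hF]
  exact evalTernary_pos_of_allRows hG h ha hb hc habc

theorem settled_of_check {n : ℕ} {u v w : Vec} {G : List (List ℤ)} {s s' : ℕ}
    (h : check n G u v w s = some s') (hG : IsTriangle 9 G)
    (hF : ∀ a b c, evalTernary G a b c = evalTernary hessRows (a * u.x + b * v.x + c * w.x)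
      (a * u.y + b * v.y + c * w.y) (a * u.z + b * v.z + c * w.z)) {a b c : ℝ}
    (ha : 0 ≤ a) (hb : 0 ≤ b) (hc : 0 ≤ c) (habc : ¬(a = 0 ∧ b = 0 ∧ c = 0)) :
    Settled (a * u.x + b * v.x + c * w.x) (a * u.y + b * v.y + c * w.y)
      (a * u.z + b * v.z + c * w.z) := by
  induction n generalizing u v w G s s' a b c with
  | zero => simp [check] at h
  | succ n ih =>
    simp only [check, forceNat_eq] at h
    split at h
    · split_ifs at h with h₀
      exact .inl ((hF a b c).symm.trans_lt (evalTernary_neg_of_allRows hG h₀ ha hb hc habc))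
    · simp only [forceVec_eq, forceRows_eq, Option.bind_eq_some_iff] at h
      obtain ⟨s'', h₁, h₂⟩ := h
      rcases le_total b a with hab | hab
      · convert ih h₁ hG.shear (fun a b c => ?_) (sub_nonneg.2 hab) hb hc ?_ using 1
        · simp only [Vec.add]; push_cast; ring
        · simp only [Vec.add]; push_cast; ring
        · simp only [Vec.add]; push_cast; ring
        · rw [evalTernary_shear, hF]
          simp only [Vec.add]
          push_cast
          congr 1 <;> ring
        · rintro ⟨h₁, h₂, h₃⟩
          exact habc ⟨by linarith, h₂, h₃⟩
      · convert ih h₂ hG.turn (fun a b c => ?_) (sub_nonneg.2 hab) ha hc ?_ using 1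
        · simp only [Vec.add]; push_cast; ring
        · simp only [Vec.add]; push_cast; ring
        · simp only [Vec.add]; push_cast; ring
        · rw [evalTernary_turn, hF]
          simp only [Vec.add]
          push_cast
          congr 1 <;> ring
        · rintro ⟨h₁, h₂, h₃⟩
          exact habc ⟨h₂, by linarith, h₃⟩
    · rw [forceRows_eq] at h
      convert ih h hG.swapSnd (fun a b c => ?_) ha hc hb (by tauto) using 1
      · ring
      · ring
      · ring
      · rw [evalTernary_swapSnd hG, hF]
        congr 1 <;> ring
    · rw [forceRows_eq] at h
      convert ih h hG.swapFst.swapSnd (fun a b c => ?_) hb hc ha (by tauto) using 1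
      · ring
      · ring
      · ring
      · rw [evalTernary_swapSnd hG.swapFst, evalTernary_swapFst, hF]
        congr 1 <;> ring
    · split_ifs at h with h₀
      exact settled_of_regionLeaf h₀ hG hF ha hb hc habc

theorem isTriangle_hessRows : IsTriangle 9 hessRows :=
  .cons rfl <| .cons rfl <| .cons rfl <| .cons rfl <| .cons rfl <| .cons rfl <| .cons rfl <|
    .cons rfl <| .cons rfl rfl

theorem settled_of_checkOctant {σ τ : ℤ} {s : ℕ} (h : checkOctant σ τ s = true) {a b c : ℝ}
    (ha : 0 ≤ a) (hb : 0 ≤ b) (hc : 0 ≤ c) (habc : ¬(a = 0 ∧ b = 0 ∧ c = 0)) :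
    Settled (σ * a) (τ * b) c := by
  rw [checkOctant, forceRows_eq, beq_iff_eq] at h
  convert settled_of_check h (isTriangle_hessRows.rescale _ _ _) (fun a b c => ?_)
    (a := a / 3) (b := b / 3) (c := c / 2) (by positivity) (by positivity) (by positivity)
    (by simpa using habc) using 1
  · push_cast; ring
  · push_cast; ring
  · push_cast; ring
  · rw [evalTernary_rescale]
    push_cast
    congr 1 <;> ring

/-! ### The certificate -/

theorem checkOctant_pos_pos :
    checkOctant 1 1 67828315143452237670582595028367736754246143174175128822544937239909123452101113384069262688288593461574826095843728071769087318406676807599681155378798876649754049750611267710400813291981782567032727075471887607619072900744072230171860559065285488414018437015555351191752333891777400170237787742495320043955100247602585031970392019158206945141327293737541324762915504188499730595216698127569857222385508294800286474627944126102242120282802805948851734095018568960882231681920462232128127749980842303505186908334702883946816766904540693952995743090803773575956812559572280662979103201081024756460876896938150058916184281765206445622392569791260470795812709683613322542378290013864241 = true := by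
  decide +kernel

theorem checkOctant_pos_neg :
    checkOctant 1 (-1) 172164936344054821128039763697113517076532567697332271141098257918340184300095890694538523073316828703610302145228575628430499523952331434394288840973444937365704506178208931296642544934433479188917553911752932016904454574973089905154707788267293872035623748310182491786754666200167911669579349565945802865024455038419149762338696924867807880779951410214004891979053325960437836448115375804257348201408690233255437411489984522692310812529239688206848271681057706527411328744918318847237970314239541016556564440854049285487388897336558516274672515694246484934656705835043969233770110005655446980694303859036940508301665751450790619201092419899430488159370256355093631453309814458998307369287219265943073127421102067292182996204979445444911957617096619393244512874186343209574705 = true := by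
  decide +kernel

theorem checkOctant_neg_pos :
    checkOctant (-1) 1 1158128429635421251790983456631586308022195107486561982525294605945268827969372337489627158237704256379556045714221665786926899002400795360502501605452381363159865029505066285126670977531452992839791608254139374697002046135152763397908657709051087751636074862066400384508799241369543826319057577501495972572968946208718663007995672276175009438252880313167517153967868225383298668580649290867234275523896987358160781970910381745146144517286266858566815911104688100357269922063647806888430767260129273684632956515192391139003099958431532243506874346187376240334733729769319224481032154926807727903127781804023037216009553768185971846665647498787796223198801917769966042128646688987751851247311822746770412631907844946465298 = true := by
  decide +kernel

theorem checkOctant_neg_neg :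
    checkOctant (-1) (-1) 3825871955162415670127911118705870992670247635095142033550833417369890299026201372728703788216860573200436440278689087383619096818423207485780612155838894790694761532586248798144549026420224930221628756985415826911043939653673200157543184626962622281346589268798213945358092578211356886179108462894879168777699205857329011145967077229756216691792243694052654144803309313577216019491994309543144293971425047191219296845572526894942777163458946710639254686053657498160883155311180172806698195082479838381987022532123626016172590644269040803251908381054071026119006597854232542034186782819209968597766161234449801268224492898624822484341605758758168221680965623022672764847019125435238341752043697929323294689188499948906609331299927411248185766075843320914286727162098452027169587185246422542579373523713332250203000107033464754906845303070371150938781574078878871758641901805241408877640924495698305283177407465564785554015900588276799530825927411568462810751320329416476291223523101769469103932580014112582126923756819740345647137666326823364683217345844993866143912127135969203580445846621865412356848417425926729055342861685653275690851333971656116895496834721067951590744363602052842616905708679473 = true := by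
  decide +kernel

/-- Every point of the half-space `z ≥ 0` other than the origin is settled. -/
theorem settled {x y z : ℝ} (hz : 0 ≤ z) (h : ¬(x = 0 ∧ y = 0 ∧ z = 0)) : Settled x y z := by
  have key {σ τ : ℤ} {s : ℕ} (hs : checkOctant σ τ s = true) (hσ : |σ| = 1) (hτ : |τ| = 1)
      (hx : σ * x = |x|) (hy : τ * y = |y|) : Settled x y z := by
    have sq {ε : ℤ} (hε : |ε| = 1) : (ε : ℝ) * ε = 1 := by
      exact_mod_cast (by rw [← abs_mul_abs_self, hε, one_mul] : ε * ε = 1)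
    convert settled_of_checkOctant hs (abs_nonneg x) (abs_nonneg y) hz (by simpa using h) using 1
    · rw [← hx, ← mul_assoc, sq hσ, one_mul]
    · rw [← hy, ← mul_assoc, sq hτ, one_mul]
  rcases le_total 0 x with hx | hx <;> rcases le_total 0 y with hy | hy
  · exact key checkOctant_pos_pos rfl rfl (by simp [abs_of_nonneg hx]) (by simp [abs_of_nonneg hy])
  · exact key checkOctant_pos_neg rfl rfl (by simp [abs_of_nonneg hx]) (by simp [abs_of_nonpos hy])
  · exact key checkOctant_neg_pos rfl rfl (by simp [abs_of_nonpos hx]) (by simp [abs_of_nonneg hy])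
  · exact key checkOctant_neg_neg rfl rfl (by simp [abs_of_nonpos hx]) (by simp [abs_of_nonpos hy])

/-! ### The Hessian of `f` -/

theorem differentiable_evalBinary (l : List ℤ) :
    Differentiable ℝ fun p : ℝ × ℝ × ℝ => evalBinary l p.1 p.2.1 := by
  induction l with
  | nil => exact differentiable_const 0
  | cons g l ih =>
    simp only [evalBinary_cons]
    fun_prop

theorem differentiable_evalTernary (G : List (List ℤ)) :
    Differentiable ℝ fun p : ℝ × ℝ × ℝ => evalTernary G p.1 p.2.1 p.2.2 := by
  induction G with
  | nil => exact differentiable_const 0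
  | cons L G ih =>
    simp only [evalTernary_cons]
    have := differentiable_evalBinary L
    fun_prop

theorem evalBinary_mul {n : ℕ} {l : List ℤ} (hl : l.length = n + 1) (s a b : ℝ) :
    evalBinary l (s * a) (s * b) = s ^ n * evalBinary l a b := by
  induction n generalizing l with
  | zero =>
    obtain ⟨x, rfl⟩ := List.length_eq_one_iff.1 hl
    simp [evalBinary]
  | succ n ih =>
    obtain ⟨x, l, rfl⟩ := List.exists_cons_of_length_eq_add_one hl
    have hl' : l.length = n + 1 := by simpa using hl
    rw [evalBinary_cons, evalBinary_cons, ih hl', hl']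
    ring

theorem evalTernary_mul {n : ℕ} {G : List (List ℤ)} (hG : IsTriangle (n + 1) G) (s a b c : ℝ) :
    evalTernary G (s * a) (s * b) (s * c) = s ^ n * evalTernary G a b c := by
  induction n generalizing G with
  | zero =>
    obtain ⟨L, G, rfl, hL, rfl⟩ := hG
    simpa [evalTernary] using evalBinary_mul hL s a b
  | succ n ih =>
    obtain ⟨L, G, rfl, hL, hG⟩ := hG
    rw [evalTernary_cons, evalTernary_cons, ih hG, evalBinary_mul hL]
    ring

/-- The Hessian of `f` as a function on the plane. -/
noncomputable def hessFun (p : ℝ × ℝ) : ℝ := evalTernary hessRows p.1 p.2 1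

theorem eval_hess (p : ℝ × ℝ) : eval ![p.1, p.2] (Hess f) = hessFun p := by
  have h01 : (0 : Fin 2) ≠ 1 := by decide
  have h10 : (1 : Fin 2) ≠ 0 := by decide
  have hC (i : Fin 2) (n : ℕ) [n.AtLeastTwo] :
      pderiv i (OfNat.ofNat n : MvPolynomial (Fin 2) ℝ) = 0 :=
    (pderiv i).map_natCast n
  simp [Hess, f, pderiv_X_of_ne h01, pderiv_X_of_ne h10, Derivation.leibniz,
    Derivation.leibniz_pow, hC]
  simp [hessFun, evalTernary, evalBinary, hessRows]
  ring

theorem differentiable_hessFun : Differentiable ℝ hessFun :=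
  (differentiable_evalTernary hessRows).comp
    (f := fun p : ℝ × ℝ => (p.1, p.2, (1 : ℝ))) (by fun_prop)

theorem hessFun_eq {x y z : ℝ} (hz : z ≠ 0) :
    evalTernary hessRows x y z = z ^ 8 * hessFun (x / z, y / z) := by
  rw [hessFun, ← evalTernary_mul isTriangle_hessRows]
  simp [mul_div_cancel₀ _ hz]

theorem evalTernary_hessRows_neg {x y : ℝ} (h : ¬(x = 0 ∧ y = 0)) :
    evalTernary hessRows x y 0 < 0 := by
  rcases settled le_rfl (by tauto : ¬(x = 0 ∧ y = 0 ∧ (0 : ℝ) = 0)) with h | ⟨R, -, h, -⟩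
  · exact h
  · exact absurd h (lt_irrefl 0)

open Filter Topology in
theorem exists_forall_hessFun_neg : ∃ ρ : ℝ, ∀ p : ℝ × ℝ, ρ ≤ ‖p‖ → hessFun p < 0 := by
  have hev : ∀ᶠ z : ℝ in 𝓝 0, ∀ q ∈ Metric.sphere (0 : ℝ × ℝ) 1,
      evalTernary hessRows q.1 q.2 z < 0 := by
    refine (isCompact_sphere (0 : ℝ × ℝ) 1).eventually_forall_of_forall_eventually fun q hq => ?_
    have hcont : Continuous fun w : ℝ × ℝ × ℝ => evalTernary hessRows w.2.1 w.2.2 w.1 :=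
      (differentiable_evalTernary hessRows).continuous.comp
        (f := fun w : ℝ × ℝ × ℝ => (w.2.1, w.2.2, w.1)) (by fun_prop)
    refine hcont.continuousAt.eventually_lt continuousAt_const (evalTernary_hessRows_neg ?_)
    rintro ⟨h₁, h₂⟩
    rw [show q = 0 from Prod.ext h₁ h₂] at hq
    simp at hq
  obtain ⟨ρ, hρ, hρ0⟩ := ((tendsto_inv_atTop_zero.eventually hev).and
    (eventually_gt_atTop (0 : ℝ))).exists_forall_of_atTop |>.imp fun ρ h =>
      (⟨fun r hr => (h r hr).1, (h ρ le_rfl).2⟩ : _ ∧ _)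
  refine ⟨ρ, fun p hp => ?_⟩
  have hp0 : 0 < ‖p‖ := hρ0.trans_le hp
  have := hρ ‖p‖ hp (‖p‖⁻¹ • p) (by simp [norm_smul, hp0.ne'])
  rw [hessFun_eq (inv_ne_zero hp0.ne')] at this
  have h2 : ((‖p‖⁻¹ • p).1 / ‖p‖⁻¹, (‖p‖⁻¹ • p).2 / ‖p‖⁻¹) = p := by
    ext <;> simp <;> field_simp
  rw [h2] at this
  exact (pos_iff_neg_of_mul_neg this).1 (by positivity)

/-- The affine part of the convex cone on which the linear forms `r` are positive. -/
def regionSet (r : List Vec) : Set (ℝ × ℝ) := {p | ∀ l ∈ r, (0 : ℝ) < l.x * p.1 + l.y * p.2 + l.z}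

theorem isOpen_regionSet (r : List Vec) : IsOpen (regionSet r) := by
  simp only [regionSet, Set.ofPred_forall]
  exact (List.finite_toSet r).isOpen_biInter fun l _ => isOpen_lt (by fun_prop) (by fun_prop)

theorem convex_regionSet (r : List Vec) : Convex ℝ (regionSet r) := by
  intro p hp q hq a b ha hb hab l hl
  have h := (convex_Ioi (0 : ℝ)) (hp l hl) (hq l hl) ha hb hab
  simp only [smul_eq_mul, Set.mem_Ioi] at h
  simp only [Prod.fst_add, Prod.snd_add, Prod.smul_fst, Prod.smul_snd, smul_eq_mul]
  calc _ < _ := h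
    _ = l.x * (a * p.1 + b * q.1) + l.y * (a * p.2 + b * q.2) + (a + b) * l.z := by ring
    _ = _ := by rw [hab, one_mul]

theorem disjoint_regionSet {r s : List Vec}
    (h : ∃ l ∈ r, ∃ m ∈ s, m.x = -l.x ∧ m.y = -l.y ∧ m.z = -l.z) :
    Disjoint (regionSet r) (regionSet s) := by
  obtain ⟨l, hl, m, hm, hx, hy, hz⟩ := h
  refine Set.disjoint_left.2 fun p hp hq => ?_
  have h₁ := hp l hl
  have h₂ := hq m hm
  rw [hx, hy, hz] at h₂
  push_cast at h₂
  linarith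

/-- The affine point with homogeneous coordinates `o`. -/
noncomputable def Vec.affine (o : Vec) : ℝ × ℝ := (o.x / o.z, o.y / o.z)

theorem regions_center : ∀ R ∈ regions, 0 < R.1.z ∧ ∀ l ∈ R.2, 0 < l.dot R.1 := by
  decide +kernel

theorem pairwise_disjoint_regions :
    Pairwise fun i j : Fin regions.length =>
      Disjoint (regionSet regions[i].2) (regionSet regions[j].2) := by
  have h : ∀ i j : Fin regions.length, i ≠ j → ∃ l ∈ regions[i].2, ∃ m ∈ regions[j].2,
      m.x = -l.x ∧ m.y = -l.y ∧ m.z = -l.z := by decide +kernel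
  exact fun i j hij => disjoint_regionSet (h i j hij)

theorem hessFun_center_pos : ∀ R ∈ regions, 0 < hessFun R.1.affine := by
  intro R hR
  have hz : (0 : ℝ) < R.1.z := by exact_mod_cast (regions_center R hR).1
  have h : 0 < evalTernary hessRows R.1.x R.1.y R.1.z := by
    revert R
    simp [regions, hessRows, evalTernary, evalBinary]
    norm_num
  rw [hessFun_eq hz.ne'] at h
  exact (pos_iff_pos_of_mul_pos h).1 (by positivity)

theorem center_mem_regionSet {R : Vec × List Vec} (hR : R ∈ regions) :
    R.1.affine ∈ regionSet R.2 := fun l hl => by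
  have hz : (0 : ℝ) < R.1.z := by exact_mod_cast (regions_center R hR).1
  have h : (0 : ℝ) < l.x * R.1.x + l.y * R.1.y + l.z * R.1.z := by
    exact_mod_cast (regions_center R hR).2 l hl
  have := div_pos h hz
  simp only [Vec.affine]
  field_simp
  linarith

theorem fderiv_pos_of_hasDerivAt {o : Vec} (ho : 0 < o.z) {p : ℝ × ℝ} (hp : hessFun p = 0)
    {r d : ℝ} (hr : 0 < r) (hd : 0 < d)
    (h : HasDerivAt (fun t : ℝ => evalTernary hessRows (p.1 + t * (r * o.x)) (p.2 + t * (r * o.y))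
      (1 + t * (r * o.z))) d 0) : 0 < fderiv ℝ hessFun p (o.affine - p) := by
  have hz : (0 : ℝ) < o.z := by exact_mod_cast ho
  set q : ℝ := r * o.z
  have hq : 0 < q := mul_pos hr hz
  have hden : HasDerivAt (fun t : ℝ => 1 + t * q) q 0 := by
    simpa using ((hasDerivAt_id (0 : ℝ)).mul_const q).const_add 1
  have hτ : HasDerivAt (fun t : ℝ => t * q / (1 + t * q)) q 0 := by
    have h : HasDerivAt (fun t : ℝ => t * q) q 0 := by
      simpa using (hasDerivAt_id (0 : ℝ)).mul_const q
    exact (h.fun_div hden (by simp)).congr_deriv (by simp)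
  have hpath : HasDerivAt (fun t : ℝ => p + (t * q / (1 + t * q)) • (o.affine - p))
      (q • (o.affine - p)) 0 := (hτ.smul_const _).const_add p
  have hcomp : HasDerivAt (fun t : ℝ => hessFun (p + (t * q / (1 + t * q)) • (o.affine - p)))
      (fderiv ℝ hessFun p (q • (o.affine - p))) 0 := by
    refine HasFDerivAt.comp_hasDerivAt (l := hessFun) (0 : ℝ) ?_ hpath
    simpa using (differentiable_hessFun p).hasFDerivAt
  have hprod := (hden.pow 8).mul hcomp
  have heq : d = _ := h.unique (hprod.congr_of_eventuallyEq ?_)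
  · rw [map_smul, smul_eq_mul] at heq
    simp [hp, -map_sub] at heq
    rw [heq] at hd
    exact (pos_iff_pos_of_mul_pos hd).1 hq
  · have hne : ∀ᶠ t : ℝ in nhds 0, 1 + t * q ≠ 0 :=
      hden.continuousAt.eventually_ne (by simp)
    filter_upwards [hne] with t ht
    rw [hessFun_eq ht]
    simp only [Pi.mul_apply, Pi.pow_apply]
    congr 2
    ext
    · simp [Vec.affine]
      field_simp
      simp only [q]
      ring
    · simp [Vec.affine]
      field_simp
      simp only [q]
      ring

theorem settled_plane (p : ℝ × ℝ) : Settled p.1 p.2 1 :=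
  settled zero_le_one fun h => one_ne_zero h.2.2

theorem exists_mem_regionSet {p : ℝ × ℝ} (hp : 0 ≤ hessFun p) :
    ∃ i : Fin regions.length, p ∈ regionSet regions[i].2 := by
  rcases settled_plane p with h | ⟨R, hR, -, h, -⟩
  · exact absurd hp h.not_ge
  · obtain ⟨i, rfl⟩ := List.mem_iff_get.1 hR
    exact ⟨i, fun l hl => by simpa using h l hl⟩

theorem fderiv_pos_of_mem_regionSet (i : Fin regions.length) {p : ℝ × ℝ}
    (hpi : p ∈ regionSet regions[i].2) (hp : hessFun p = 0) :
    0 < fderiv ℝ hessFun p (regions[i].1.affine - p) := by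
  rcases settled_plane p with h | ⟨R, hR, -, h, hR'⟩
  · exact absurd hp h.ne
  · obtain ⟨j, rfl⟩ := List.mem_iff_get.1 hR
    obtain rfl : i = j := by
      by_contra hij
      exact Set.disjoint_left.1 (pairwise_disjoint_regions hij) hpi
        fun l hl => by simpa using h l hl
    obtain ⟨r, d, hr, hd, hderiv⟩ := hR'.resolve_left hp.not_gt
    exact fderiv_pos_of_hasDerivAt (regions_center _ hR).1 hp hr hd hderiv

/-- The hessian curve of `f` is compact and has exactly 11 connected components. -/
theorem hessian_curve_components :
    IsCompact Z ∧ (components Z).ncard = 11 := by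
  obtain ⟨ρ, hρ⟩ := exists_forall_hessFun_neg
  rw [show Z = {p | hessFun p = 0} from Set.ext fun p => by simp only [Z, eval_hess]]
  exact ncard_components_of_ovals (U := fun i : Fin regions.length => regionSet regions[i].2)
    (c := fun i => regions[i].1.affine) differentiable_hessFun
    (fun i => isOpen_regionSet _) (fun i => convex_regionSet _) pairwise_disjoint_regions
    (fun i => center_mem_regionSet (List.getElem_mem _))
    (fun i => hessFun_center_pos _ (List.getElem_mem _)) (fun p => exists_mem_regionSet) hρ
    fun i p => fderiv_pos_of_mem_regionSet i
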